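/- arXiv:2309.16384 — 2 statements merged into one kernel-verified Lean document; each statement's English description precedes it below -/
import Mathlib

section
/- Let δ ∈ (0, 1]. Let Q be a finite nonempty set of points in EuclideanSpace ℝ (Fin d) with cost(Q, μ(Q)) > 0, and let C be a finite nonempty set of points. Set α := cost(Q, C) / cost(Q, μ(Q)) and assume α > 2 + 3δ. Then cost(core_δ(Q), C) ≥ (δ/(1+δ)) · ((√(α − 1) − (1 + δ))² / α) · cost(Q, C). In particular, a point of Q sampled with probability proportional to its cost with respect to C (the D²-distribution restricted to Q) lies in core_δ(Q) with probability at least (δ/(1+δ)) · (√(α − 1) − (1 + δ))² / α. -/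
open Finset

/-- `cost Q c = ∑_{q ∈ Q} ‖q - c‖²` -/
noncomputable def cost {d : ℕ} (Q : Finset (EuclideanSpace ℝ (Fin d)))
    (c : EuclideanSpace ℝ (Fin d)) : ℝ := ∑ q ∈ Q, ‖q - c‖ ^ 2

/-- `costS Q C = ∑_{q ∈ Q} min_{c ∈ C} ‖q - c‖²` (for nonempty `C`). -/
noncomputable def costS {d : ℕ} (Q C : Finset (EuclideanSpace ℝ (Fin d))) : ℝ :=
  ∑ q ∈ Q, sInf ((fun c => ‖q - c‖ ^ 2) '' (C : Set (EuclideanSpace ℝ (Fin d))))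

/-- `mu Q` is the centroid (mean) of the finite set `Q`. -/
noncomputable def mu {d : ℕ} (Q : Finset (EuclideanSpace ℝ (Fin d))) :
    EuclideanSpace ℝ (Fin d) := (Q.card : ℝ)⁻¹ • ∑ q ∈ Q, q

theorem cost_eq_cost_mu_add {d : ℕ} (Q : Finset (EuclideanSpace ℝ (Fin d))) (hQ : Q.Nonempty)
    (c : EuclideanSpace ℝ (Fin d)) :
    cost Q c = cost Q (mu Q) + (Q.card : ℝ) * ‖mu Q - c‖ ^ 2 := by
  have hn : (Q.card : ℝ) ≠ 0 := by exact_mod_cast hQ.card_ne_zero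
  have hsum : ∑ q ∈ Q, (q - mu Q) = 0 := by
    rw [Finset.sum_sub_distrib, Finset.sum_const, ← Nat.cast_smul_eq_nsmul ℝ, mu,
      smul_inv_smul₀ hn, sub_self]
  have hexp : ∀ q ∈ Q, ‖q - c‖ ^ 2 =
      ‖q - mu Q‖ ^ 2 + 2 * inner ℝ (q - mu Q) (mu Q - c) + ‖mu Q - c‖ ^ 2 := fun q _ => by
    rw [← norm_add_sq_real, sub_add_sub_cancel]
  rw [cost, Finset.sum_congr rfl hexp, Finset.sum_add_distrib, Finset.sum_add_distrib,
    ← Finset.mul_sum, ← sum_inner, hsum, inner_zero_left, Finset.sum_const, nsmul_eq_mul, cost]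
  ring

theorem costS_le_cost {d : ℕ} (Q C : Finset (EuclideanSpace ℝ (Fin d)))
    {c : EuclideanSpace ℝ (Fin d)} (hc : c ∈ C) : costS Q C ≤ cost Q c :=
  Finset.sum_le_sum fun _ _ => csInf_le ⟨0, by rintro _ ⟨x, _, rfl⟩; positivity⟩ ⟨c, hc, rfl⟩

theorem card_mul_le_costS {d : ℕ} (Q C : Finset (EuclideanSpace ℝ (Fin d))) (hC : C.Nonempty)
    {r : ℝ} (h : ∀ q ∈ Q, ∀ c ∈ C, r ≤ ‖q - c‖ ^ 2) : (Q.card : ℝ) * r ≤ costS Q C := by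
  rw [← nsmul_eq_mul]
  refine Finset.card_nsmul_le_sum _ _ _ fun q hq => le_csInf ?_ ?_
  · exact (Finset.coe_nonempty.mpr hC).image _
  · rintro _ ⟨c, hc, rfl⟩
    exact h q hq c hc

theorem card_sub_card_filter_mul_sq_le_cost {d : ℕ} (Q : Finset (EuclideanSpace ℝ (Fin d)))
    (c : EuclideanSpace ℝ (Fin d)) {r : ℝ} (hr : 0 ≤ r) :
    ((Q.card : ℝ) - ((Q.filter fun q => ‖q - c‖ ≤ r).card : ℝ)) * r ^ 2 ≤ cost Q c := by
  have hcard := Finset.card_filter_add_card_filter_not (s := Q) (fun q => ‖q - c‖ ≤ r)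
  have hcard' : (Q.card : ℝ) - ((Q.filter fun q => ‖q - c‖ ≤ r).card : ℝ) =
      ((Q.filter fun q => ¬ ‖q - c‖ ≤ r).card : ℝ) := by
    rw [← hcard]; push_cast; ring
  rw [hcard', ← nsmul_eq_mul]
  refine (Finset.card_nsmul_le_sum _ (fun q => ‖q - c‖ ^ 2) _ fun q hq => ?_).trans
    (Finset.sum_le_sum_of_subset_of_nonneg (Finset.filter_subset _ _) fun _ _ _ => sq_nonneg _)
  exact pow_le_pow_left₀ hr (not_le.mp (Finset.mem_filter.mp hq).2).le 2

/-- Lemma 2.2 with explicit constants: if `α := cost(Q, C)/cost(Q, μ(Q)) > 2 + 3δ`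
then the δ-core of `Q` carries at least a `(δ/(1+δ))·(√(α−1) − (1+δ))²/α` fraction of
the current cost of `Q`; dividing by `cost(Q, C)` this is exactly the probability that a
`D²`-sample from `Q` lands in the core. -/
theorem sample_from_core {d : ℕ} (δ : ℝ) (hδ0 : 0 < δ) (hδ1 : δ ≤ 1)
    (Q : Finset (EuclideanSpace ℝ (Fin d))) (hQ : Q.Nonempty)
    (hQpos : 0 < cost Q (mu Q))
    (ρ : ℝ) (hρ0 : 0 ≤ ρ) (hρ : ρ ^ 2 * (Q.card : ℝ) = cost Q (mu Q))
    (C : Finset (EuclideanSpace ℝ (Fin d))) (hC : C.Nonempty)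
    (α : ℝ) (hα : α = costS Q C / cost Q (mu Q)) (hαbig : α > 2 + 3 * δ) :
    costS (Q.filter (fun q => ‖q - mu Q‖ ≤ (1 + δ) * ρ)) C ≥
      (δ / (1 + δ)) * ((Real.sqrt (α - 1) - (1 + δ)) ^ 2 / α) * costS Q C := by
  obtain ⟨c₀, hc₀, hmin⟩ := C.exists_min_image (fun c => ‖mu Q - c‖) hC
  have hn : (0 : ℝ) < Q.card := by exact_mod_cast hQ.card_pos
  have hρpos : 0 < ρ := by
    refine hρ0.lt_of_ne' fun h => ?_
    rw [h] at hρ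
    norm_num at hρ
    exact hQpos.ne hρ
  have hcost : costS Q C = α * cost Q (mu Q) := by rw [hα, div_mul_cancel₀ _ hQpos.ne']
  have hdist : Real.sqrt (α - 1) * ρ ≤ ‖mu Q - c₀‖ := by
    refine le_of_sq_le_sq ?_ (norm_nonneg _)
    rw [mul_pow, Real.sq_sqrt (by linarith)]
    have h := costS_le_cost Q C hc₀
    rw [cost_eq_cost_mu_add Q hQ, hcost, ← hρ] at h
    refine le_of_mul_le_mul_right ?_ hn
    linarith
  have hs : 0 ≤ Real.sqrt (α - 1) - (1 + δ) :=
    sub_nonneg.mpr (Real.le_sqrt_of_sq_le (by nlinarith))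
  have hcore := card_mul_le_costS (Q.filter fun q => ‖q - mu Q‖ ≤ (1 + δ) * ρ) C hC
    (r := ((Real.sqrt (α - 1) - (1 + δ)) * ρ) ^ 2) fun q hq c hc => by
      refine pow_le_pow_left₀ (mul_nonneg hs hρ0) ?_ 2
      have h₁ := (Finset.mem_filter.mp hq).2
      have h₂ := norm_sub_le_norm_sub_add_norm_sub (mu Q) q c
      rw [norm_sub_rev (mu Q) q] at h₂
      linarith [hmin c hc]
  have hmarkov := card_sub_card_filter_mul_sq_le_cost Q (mu Q) (r := (1 + δ) * ρ) (by positivity)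
  refine le_trans ?_ hcore
  generalize ((Q.filter fun q => ‖q - mu Q‖ ≤ (1 + δ) * ρ).card : ℝ) = k at hmarkov ⊢
  have hk : δ / (1 + δ) * Q.card ≤ k := by
    have h : ((Q.card : ℝ) - k) * (1 + δ) ^ 2 ≤ Q.card := by
      refine le_of_mul_le_mul_right ?_ (pow_pos hρpos 2)
      linarith
    rw [div_mul_eq_mul_div, div_le_iff₀ (by positivity)]
    refine le_of_mul_le_mul_right ?_ (show 0 < 1 + δ by positivity)
    nlinarith [mul_pos hδ0 hn]
  have hα0 : α ≠ 0 := by linarith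
  calc _ = δ / (1 + δ) * Q.card * ((Real.sqrt (α - 1) - (1 + δ)) * ρ) ^ 2 := by
        rw [hcost, ← hρ]
        generalize Real.sqrt (α - 1) = s
        clear hα hαbig
        field_simp
    _ ≤ _ := by gcongr
end

section
/- Let P be a finite set of points in EuclideanSpace ℝ (Fin d), let O and C be finite nonempty sets of points, let f : P → E be an assignment with f(p) ∈ O for all p ∈ P such that for every o ∈ O whose fiber P_o := {p ∈ P : f(p) = o} is nonempty one has o = μ(P_o), and let g : E → E satisfy g(x) ∈ C and ‖x − g(x)‖ ≤ ‖x − c‖ for every x ∈ E and every c ∈ C (a nearest-point map onto C). Set OPT := Σ_{p ∈ P} ‖p − f(p)‖² and ALG := Σ_{p ∈ P} ‖p − g(p)‖². Then Σ_{p ∈ P} ‖p − g(f(p))‖² ≤ 2·OPT + ALG + 2·√(ALG) · √(OPT). -/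
open Finset

/-- The deviations of the points of a nonempty finite set from its centroid sum to zero. -/
lemma sum_sub_mu {d : ℕ} {Q : Finset (EuclideanSpace ℝ (Fin d))} (hQ : Q.Nonempty) :
    ∑ q ∈ Q, (q - mu Q) = 0 := by
  have hcard : (Q.card : ℝ) ≠ 0 := Nat.cast_ne_zero.mpr hQ.card_ne_zero
  rw [sum_sub_distrib, sum_const, ← Nat.cast_smul_eq_nsmul ℝ, mu, smul_inv_smul₀ hcard, sub_self]

/-- If every nonempty fiber of `f` has its value as centroid, then the deviations `p - f p` are
orthogonal to every function that is constant on the fibers. -/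
lemma sum_inner_sub_eq_zero {d : ℕ} [DecidableEq (EuclideanSpace ℝ (Fin d))]
    {P O : Finset (EuclideanSpace ℝ (Fin d))}
    {f : EuclideanSpace ℝ (Fin d) → EuclideanSpace ℝ (Fin d)}
    (hfO : ∀ p ∈ P, f p ∈ O)
    (hfmean : ∀ o ∈ O, (P.filter (fun p => f p = o)).Nonempty →
      o = mu (P.filter (fun p => f p = o)))
    (h : EuclideanSpace ℝ (Fin d) → EuclideanSpace ℝ (Fin d)) :
    ∑ p ∈ P, inner ℝ (p - f p) (h (f p)) = 0 := by
  rw [← sum_fiberwise_of_maps_to hfO]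
  refine sum_eq_zero fun o ho => ?_
  have hfiber : ∑ p ∈ P with f p = o, inner ℝ (p - f p) (h (f p)) =
      ∑ p ∈ P with f p = o, inner ℝ (p - o) (h o) :=
    sum_congr rfl fun p hp => by rw [(mem_filter.mp hp).2]
  rw [hfiber, ← sum_inner]
  rcases (P.filter (fun p => f p = o)).eq_empty_or_nonempty with hempty | hne
  · simp [hempty]
  · have hsum := sum_sub_mu hne
    rw [← hfmean o ho hne] at hsum
    rw [hsum, inner_zero_left]

/-- Lemma 3.5 (reassignment cost bound): if `f` assigns every point of `P` to an optimal
center in `O` (each optimal center being the centroid of its fiber) and `g` is a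
nearest-point map onto the current centers `C`, then
`Σ_{p ∈ P} ‖p − g(f(p))‖² ≤ 2·OPT + ALG + 2·√ALG·√OPT`. -/
theorem reassignment_cost {d : ℕ}
    [DecidableEq (EuclideanSpace ℝ (Fin d))]
    (P O C : Finset (EuclideanSpace ℝ (Fin d))) (hO : O.Nonempty) (hC : C.Nonempty)
    (f : EuclideanSpace ℝ (Fin d) → EuclideanSpace ℝ (Fin d))
    (hfO : ∀ p ∈ P, f p ∈ O)
    (hfmean : ∀ o ∈ O, (P.filter (fun p => f p = o)).Nonempty →
      o = mu (P.filter (fun p => f p = o)))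
    (g : EuclideanSpace ℝ (Fin d) → EuclideanSpace ℝ (Fin d))
    (hgC : ∀ x, g x ∈ C)
    (hgmin : ∀ x, ∀ c ∈ C, ‖x - g x‖ ≤ ‖x - c‖)
    (OPT ALG : ℝ)
    (hOPT : OPT = ∑ p ∈ P, ‖p - f p‖ ^ 2)
    (hALG : ALG = ∑ p ∈ P, ‖p - g p‖ ^ 2) :
    ∑ p ∈ P, ‖p - g (f p)‖ ^ 2 ≤
      2 * OPT + ALG + 2 * Real.sqrt ALG * Real.sqrt OPT := by
  have hpoint : ∀ p ∈ P, ‖p - g (f p)‖ ^ 2 ≤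
      2 * ‖p - f p‖ ^ 2 + ‖p - g p‖ ^ 2 + 2 * (‖p - g p‖ * ‖p - f p‖) +
        2 * inner ℝ (p - f p) (f p - g (f p)) := by
    intro p _
    have hexpand := norm_add_sq_real (p - f p) (f p - g (f p))
    rw [sub_add_sub_cancel] at hexpand
    have hdist : ‖f p - g (f p)‖ ≤ ‖p - f p‖ + ‖p - g p‖ := by
      calc ‖f p - g (f p)‖ ≤ ‖f p - g p‖ := hgmin _ _ (hgC p)
        _ ≤ ‖f p - p‖ + ‖p - g p‖ := norm_sub_le_norm_sub_add_norm_sub _ _ _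
        _ = ‖p - f p‖ + ‖p - g p‖ := by rw [norm_sub_rev]
    have hsq := pow_le_pow_left₀ (norm_nonneg _) hdist 2
    linarith
  have hcross := sum_inner_sub_eq_zero hfO hfmean (fun o => o - g o)
  have hcs := Real.sum_mul_le_sqrt_mul_sqrt P (fun p => ‖p - g p‖) (fun p => ‖p - f p‖)
  have hsum := sum_le_sum hpoint
  simp only [sum_add_distrib, ← mul_sum] at hsum
  rw [← hOPT, ← hALG] at hsum hcs
  linarith
end
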